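/- arXiv:2110.15416 — 2 statements merged into one kernel-verified Lean document; each statement's English description precedes it below -/
import Mathlib

section
/- Let L(λ) be a pencil in the assumed block upper triangular form with diagonal blocks L_ℓ(λ), R(λ), L_r(λ). Then a set {v_i(λ)}_{i=1}^s is a maximal set of root polynomials at λ_0 for R(λ), with orders ℓ_1,…,ℓ_s, if and only if there is a maximal set of root polynomials at λ_0 for L(λ) of the same orders ℓ_1,…,ℓ_s having the form {q_i(λ)}_{i=1}^s with q_i(λ)=[u_i(λ); v_i(λ); 0]+(λ−λ_0)^{ℓ_i} r_i(λ) for some polynomial vectors u_i(λ) and r_i(λ), i=1,…,s; moreover, when A(λ)=0 one may take u_i(λ)=0 in the forward direction. -/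
open Polynomial Matrix

noncomputable section

/-- The matrix pencil `L₀ + λ L₁` viewed as a polynomial matrix. -/
def pencilMat {ι κ : Type*} (L0 L1 : Matrix ι κ ℂ) : Matrix ι κ (Polynomial ℂ) :=
  Matrix.of fun i j => Polynomial.C (L0 i j) + Polynomial.X * Polynomial.C (L1 i j)

/-- Entrywise evaluation of a polynomial matrix at a point. -/
def evalMat {ι κ : Type*} (P : Matrix ι κ (Polynomial ℂ)) (μ : ℂ) : Matrix ι κ ℂ :=
  P.map fun p => p.eval μ

/-- A polynomial matrix viewed over the field ℂ(λ) of rational functions. -/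
def toRat {ι κ : Type*} (P : Matrix ι κ (Polynomial ℂ)) : Matrix ι κ (RatFunc ℂ) :=
  P.map (algebraMap (Polynomial ℂ) (RatFunc ℂ))

/-- The normal rank of a polynomial matrix: its rank over ℂ(λ). -/
def normalRank {ι κ : Type*} [Fintype κ] (P : Matrix ι κ (Polynomial ℂ)) : ℕ :=
  (toRat P).rank

/-- The right nullspace of a polynomial matrix, as a ℂ(λ)-subspace of ℂ(λ)^κ. -/
def rightNullspace {ι κ : Type*} [Fintype κ] (P : Matrix ι κ (Polynomial ℂ)) :
    Submodule (RatFunc ℂ) (κ → RatFunc ℂ) :=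
  LinearMap.ker (toRat P).mulVecLin

/-- The degree of a polynomial (column) vector: maximum of the degrees of its entries. -/
def colDegree {ι : Type*} [Fintype ι] (v : ι → Polynomial ℂ) : ℕ :=
  Finset.univ.sup fun i => (v i).natDegree

/-- The columns of the polynomial matrix `N` form a minimal polynomial basis of the right
nullspace of `P`: they are a ℂ(λ)-basis of `rightNullspace P` and the sum of the column
degrees is minimal among all polynomial bases. -/
def IsMinimalBasis {ι κ : Type*} [Fintype ι] [Fintype κ] (P : Matrix ι κ (Polynomial ℂ))
    {p : ℕ} (N : Matrix κ (Fin p) (Polynomial ℂ)) : Prop :=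
  LinearIndependent (RatFunc ℂ) (fun j : Fin p => fun i : κ => toRat N i j) ∧
  Submodule.span (RatFunc ℂ) (Set.range fun j : Fin p => fun i : κ => toRat N i j)
    = rightNullspace P ∧
  ∀ M : Matrix κ (Fin p) (Polynomial ℂ),
    LinearIndependent (RatFunc ℂ) (fun j : Fin p => fun i : κ => toRat M i j) →
    Submodule.span (RatFunc ℂ) (Set.range fun j : Fin p => fun i : κ => toRat M i j)
      = rightNullspace P →
    (∑ j, colDegree fun i => N i j) ≤ ∑ j, colDegree fun i => M i j

/-- `x(λ)` is a right zero direction of order `k ≥ 1` for `P` at `λ₀`: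
`x(λ₀) ≠ 0` and `P(λ)x(λ) = (λ-λ₀)^k v(λ)` with `v` defined and nonzero at `λ₀`. -/
def IsZeroDirection {ι κ : Type*} [Fintype κ] (P : Matrix ι κ (Polynomial ℂ)) (lam0 : ℂ)
    (k : ℕ) (x : κ → Polynomial ℂ) : Prop :=
  0 < k ∧ (fun i => (x i).eval lam0) ≠ 0 ∧
  (∀ i, (Polynomial.X - Polynomial.C lam0) ^ k ∣ P.mulVec x i) ∧
  ¬ ∀ i, (Polynomial.X - Polynomial.C lam0) ^ (k + 1) ∣ P.mulVec x i

/-- `x(λ)` is a root polynomial of order (exactly) `k` at `λ₀` for `P`: it is a zero direction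
of order `k` and, for every right minimal basis `N` of `P`, `[N(λ₀) x(λ₀)]` has full column
rank. -/
def IsRootPoly {ι κ : Type*} [Fintype ι] [Fintype κ] (P : Matrix ι κ (Polynomial ℂ)) (lam0 : ℂ)
    (k : ℕ) (x : κ → Polynomial ℂ) : Prop :=
  IsZeroDirection P lam0 k x ∧
  ∀ (p : ℕ) (N : Matrix κ (Fin p) (Polynomial ℂ)), IsMinimalBasis P N →
    (Matrix.of fun (i : κ) (j : Sum (Fin p) (Fin 1)) =>
      Sum.elim (fun a => (N i a).eval lam0) (fun _ => (x i).eval lam0) j).rank = p + 1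

/-- `r 0, …, r (s-1)` is a `λ₀`-independent set of root polynomials of orders `k 0, …, k (s-1)`
for `P`: each is a root polynomial and `[N(λ₀) r₁(λ₀) … r_s(λ₀)]` has full column rank for
every right minimal basis `N`. -/
def IsIndepFamily {ι κ : Type*} [Fintype ι] [Fintype κ] (P : Matrix ι κ (Polynomial ℂ))
    (lam0 : ℂ) {s : ℕ} (k : Fin s → ℕ) (r : Fin s → κ → Polynomial ℂ) : Prop :=
  (∀ i, IsRootPoly P lam0 (k i) (r i)) ∧
  ∀ (p : ℕ) (N : Matrix κ (Fin p) (Polynomial ℂ)), IsMinimalBasis P N →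
    (Matrix.of fun (i : κ) (j : Sum (Fin p) (Fin s)) =>
      Sum.elim (fun a => (N i a).eval lam0) (fun b => (r b i).eval lam0) j).rank = p + s

/-- A complete set of root polynomials: a `λ₀`-independent set such that no `λ₀`-independent
set with more elements exists. -/
def IsCompleteFamily {ι κ : Type*} [Fintype ι] [Fintype κ] (P : Matrix ι κ (Polynomial ℂ))
    (lam0 : ℂ) {s : ℕ} (k : Fin s → ℕ) (r : Fin s → κ → Polynomial ℂ) : Prop :=
  IsIndepFamily P lam0 k r ∧
  ∀ (s' : ℕ) (k' : Fin s' → ℕ) (r' : Fin s' → κ → Polynomial ℂ),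
    IsIndepFamily P lam0 k' r' → s' ≤ s

/-- A maximal set of root polynomials at `λ₀`: complete, ordered (`k₁ ≥ … ≥ k_s > 0`), and for
every `j` there is no root polynomial of order `> k j` that stays `λ₀`-independent together
with `r₁, …, r_{j-1}`. -/
def IsMaximalFamily {ι κ : Type*} [Fintype ι] [Fintype κ] (P : Matrix ι κ (Polynomial ℂ))
    (lam0 : ℂ) {s : ℕ} (k : Fin s → ℕ) (r : Fin s → κ → Polynomial ℂ) : Prop :=
  IsCompleteFamily P lam0 k r ∧ Antitone k ∧ (∀ i, 0 < k i) ∧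
  ∀ (j : Fin s) (k' : ℕ), k j < k' → ∀ x : κ → Polynomial ℂ, IsRootPoly P lam0 k' x →
    ¬ ∀ (p : ℕ) (N : Matrix κ (Fin p) (Polynomial ℂ)), IsMinimalBasis P N →
      (Matrix.of fun (i : κ) (c : Sum (Fin p) (Fin ((j : ℕ) + 1))) =>
        Sum.elim (fun a => (N i a).eval lam0)
          (fun b => if h : (b : ℕ) < (j : ℕ) then (r ⟨(b : ℕ), h.trans j.isLt⟩ i).eval lam0
                    else (x i).eval lam0) c).rank = p + (j : ℕ) + 1

/-- `σ 0 ≤ … ≤ σ (r-1)` are the partial multiplicities of `P` at `λ₀`: there is a local Smith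
form `M(λ) P(λ) N(λ) = diag((λ-λ₀)^{σ i}) ⊕ 0` (up to positioning of the diagonal) with `M`,
`N` polynomial and invertible at `λ₀`. -/
def HasPartialMultiplicities {ι κ : Type*} [Fintype ι] [Fintype κ] [DecidableEq ι]
    [DecidableEq κ] (P : Matrix ι κ (Polynomial ℂ)) (lam0 : ℂ) {r : ℕ} (σ : Fin r → ℕ) : Prop :=
  Monotone σ ∧
  ∃ (M : Matrix ι ι (Polynomial ℂ)) (N : Matrix κ κ (Polynomial ℂ))
    (fR : Fin r → ι) (fC : Fin r → κ),
    Function.Injective fR ∧ Function.Injective fC ∧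
    (evalMat M lam0).det ≠ 0 ∧ (evalMat N lam0).det ≠ 0 ∧
    M * P * N = Matrix.of fun i j =>
      ∑ a : Fin r, if i = fR a ∧ j = fC a then (Polynomial.X - Polynomial.C lam0) ^ σ a else 0

/-- Every entry of the polynomial matrix has degree at most one, i.e. the matrix is a pencil. -/
def IsPencilMat {ι κ : Type*} (M : Matrix ι κ (Polynomial ℂ)) : Prop :=
  ∀ i j, (M i j).natDegree ≤ 1

/-- The block upper triangular matrix `[[Lℓ, A, B], [0, R, C], [0, 0, Lr]]`. -/
def blockTri {m1 m2 m3 n1 n3 : ℕ}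
    (Ll : Matrix (Fin m1) (Fin n1) (Polynomial ℂ))
    (Am : Matrix (Fin m1) (Fin m2) (Polynomial ℂ))
    (Bm : Matrix (Fin m1) (Fin n3) (Polynomial ℂ))
    (Rm : Matrix (Fin m2) (Fin m2) (Polynomial ℂ))
    (Cm : Matrix (Fin m2) (Fin n3) (Polynomial ℂ))
    (Lr : Matrix (Fin m3) (Fin n3) (Polynomial ℂ)) :
    Matrix (Fin m1 ⊕ Fin m2 ⊕ Fin m3) (Fin n1 ⊕ Fin m2 ⊕ Fin n3) (Polynomial ℂ) :=
  Matrix.of fun r c =>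
    match r, c with
    | Sum.inl i, Sum.inl j => Ll i j
    | Sum.inl i, Sum.inr (Sum.inl j) => Am i j
    | Sum.inl i, Sum.inr (Sum.inr j) => Bm i j
    | Sum.inr (Sum.inl _), Sum.inl _ => 0
    | Sum.inr (Sum.inl i), Sum.inr (Sum.inl j) => Rm i j
    | Sum.inr (Sum.inl i), Sum.inr (Sum.inr j) => Cm i j
    | Sum.inr (Sum.inr _), Sum.inl _ => 0
    | Sum.inr (Sum.inr _), Sum.inr (Sum.inl _) => 0
    | Sum.inr (Sum.inr i), Sum.inr (Sum.inr j) => Lr i j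
section RootPolynomials

/-- Entrywise evaluation of a polynomial vector at a point. -/
def evalVec {κ : Type*} (x : κ → ℂ[X]) (μ : ℂ) : κ → ℂ := fun i => (x i).eval μ

theorem evalVec_mulVec {ι κ : Type*} [Fintype κ] (P : Matrix ι κ ℂ[X]) (x : κ → ℂ[X]) (μ : ℂ) :
    evalVec (P *ᵥ x) μ = evalMat P μ *ᵥ evalVec x μ := by
  ext i
  simp [evalVec, evalMat, mulVec, dotProduct, eval_finsetSum]

theorem evalVec_eq_zero_iff {κ : Type*} (x : κ → ℂ[X]) (μ : ℂ) :
    evalVec x μ = 0 ↔ ∀ i, (X - C μ) ∣ x i := by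
  simp [funext_iff, evalVec, dvd_iff_isRoot]

theorem exists_exact_order {κ : Type*} {y : κ → ℂ[X]} (hy : y ≠ 0) {μ : ℂ} {k : ℕ}
    (hk : ∀ i, (X - C μ) ^ k ∣ y i) :
    ∃ k', k ≤ k' ∧ (∀ i, (X - C μ) ^ k' ∣ y i) ∧ ¬ ∀ i, (X - C μ) ^ (k' + 1) ∣ y i := by
  by_contra! hcon
  obtain ⟨i, hi⟩ := Function.ne_iff.1 hy
  have hall : ∀ n, ∀ i, (X - C μ) ^ (k + n) ∣ y i := by
    intro n
    induction n with
    | zero => exact hk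
    | succ n ih => exact hcon _ (Nat.le_add_right _ _) ih
  have := natDegree_le_of_dvd (hall ((y i).natDegree + 1) i) hi
  rw [natDegree_pow, natDegree_X_sub_C] at this
  omega

theorem mulVec_injective_of_rank_eq {ι : Type*} {n : ℕ} {K : Type*} [Field K]
    {P : Matrix ι (Fin n) K} (h : P.rank = n) :
    Function.Injective P.mulVec := by
  have h1 := LinearMap.finrank_range_add_finrank_ker P.mulVecLin
  have h2 : Module.finrank K (LinearMap.range P.mulVecLin) = n := h
  rw [h2, Module.finrank_fin_fun] at h1
  have h3 : LinearMap.ker P.mulVecLin = ⊥ := Submodule.finrank_eq_zero.1 (by omega)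
  exact LinearMap.ker_eq_bot.1 h3

theorem pow_dvd_of_pow_dvd_mulVec {ι κ : Type*} [Fintype κ] {P : Matrix ι κ ℂ[X]} {μ : ℂ}
    (hP : Function.Injective (evalMat P μ).mulVec) (k : ℕ) (y : κ → ℂ[X])
    (h : ∀ i, (X - C μ) ^ k ∣ (P *ᵥ y) i) (j : κ) : (X - C μ) ^ k ∣ y j := by
  induction k generalizing j with
  | zero => simp
  | succ k ih =>
    choose z hz using ih fun i => (pow_dvd_pow _ k.le_succ).trans (h i)
    have hyz : y = (X - C μ) ^ k • z := funext fun j => by simp [hz j]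
    have h0 : evalVec z μ = 0 := by
      apply hP
      rw [mulVec_zero, ← evalVec_mulVec, evalVec_eq_zero_iff]
      intro i
      have := h i
      rw [hyz, mulVec_smul, Pi.smul_apply, smul_eq_mul, pow_succ] at this
      exact (mul_dvd_mul_iff_left (pow_ne_zero _ (X_sub_C_ne_zero μ))).1 this
    rw [hz j, pow_succ]
    exact mul_dvd_mul_left _ ((evalVec_eq_zero_iff z μ).1 h0 j)

/-- The `j`-th column of a polynomial matrix, viewed over `ℂ(λ)`. -/
def ratCol {κ : Type*} {p : ℕ} (N : Matrix κ (Fin p) ℂ[X]) (j : Fin p) : κ → RatFunc ℂ :=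
  fun i => toRat N i j

/-- The `j`-th column of a polynomial matrix, evaluated at a point. -/
def evalCol {κ : Type*} {p : ℕ} (N : Matrix κ (Fin p) ℂ[X]) (μ : ℂ) (j : Fin p) : κ → ℂ :=
  fun i => (N i j).eval μ

theorem toRat_mulVec {ι κ : Type*} [Fintype κ] (P : Matrix ι κ ℂ[X]) (x : κ → ℂ[X]) :
    (toRat P *ᵥ fun i => algebraMap ℂ[X] (RatFunc ℂ) (x i)) =
      fun i => algebraMap ℂ[X] (RatFunc ℂ) ((P *ᵥ x) i) := by
  ext i
  simp [toRat, mulVec, dotProduct]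

theorem mulVec_col_of_span_eq {ι κ : Type*} [Fintype κ] {P : Matrix ι κ ℂ[X]}
    {p : ℕ} {N : Matrix κ (Fin p) ℂ[X]}
    (hN : Submodule.span (RatFunc ℂ) (Set.range (ratCol N)) = rightNullspace P) (j : Fin p) :
    (P *ᵥ fun i => N i j) = 0 := by
  have h : ratCol N j ∈ rightNullspace P := hN ▸ Submodule.subset_span ⟨j, rfl⟩
  have h1 : toRat P *ᵥ ratCol N j = 0 := h
  have h2 := toRat_mulVec P fun i => N i j
  ext1 i
  have h3 := congrFun (h2.symm.trans h1) i
  simpa using h3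

theorem linearIndependent_of_span_le {K V : Type*} [Field K] [AddCommGroup V] [Module K V]
    {p : ℕ} {b c : Fin p → V} (hb : LinearIndependent K b)
    (h : Submodule.span K (Set.range b) ≤ Submodule.span K (Set.range c)) :
    LinearIndependent K c := by
  have : FiniteDimensional K (Submodule.span K (Set.range c)) :=
    FiniteDimensional.span_of_finite K (Set.finite_range c)
  have h1 := finrank_span_eq_card hb
  have h2 := Submodule.finrank_mono h
  have h3 : Module.finrank K (Submodule.span K (Set.range c)) ≤ Fintype.card (Fin p) :=
    finrank_range_le_card c
  exact linearIndependent_iff_card_eq_finrank_span.2 (le_antisymm (h1 ▸ h2) h3)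

theorem exists_isMinimalBasis {ι κ : Type*} [Fintype ι] [Fintype κ] (P : Matrix ι κ ℂ[X]) :
    ∃ (p : ℕ) (N : Matrix κ (Fin p) ℂ[X]), IsMinimalBasis P N := by
  classical
  let p := Module.finrank (RatFunc ℂ) (rightNullspace P)
  let S : Set (Matrix κ (Fin p) ℂ[X]) := {N | LinearIndependent (RatFunc ℂ) (ratCol N) ∧
    Submodule.span (RatFunc ℂ) (Set.range (ratCol N)) = rightNullspace P}
  have hS : S.Nonempty := by
    let b := Module.finBasis (RatFunc ℂ) (rightNullspace P)
    have hb : LinearIndependent (RatFunc ℂ) fun j => (b j : κ → RatFunc ℂ) :=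
      b.linearIndependent.map' (rightNullspace P).subtype (Submodule.ker_subtype _)
    have hclear : ∀ j, ∃ d : nonZeroDivisors ℂ[X], ∀ i,
        IsLocalization.IsInteger ℂ[X] ((d : ℂ[X]) • (b j : κ → RatFunc ℂ) i) := fun j =>
      IsLocalization.exist_integer_multiples_of_finite (nonZeroDivisors ℂ[X])
        (b j : κ → RatFunc ℂ)
    choose d hd using hclear
    choose N hN using hd
    have hne : ∀ j, algebraMap ℂ[X] (RatFunc ℂ) (d j) ≠ 0 := fun j =>
      IsFractionRing.to_map_ne_zero_of_mem_nonZeroDivisors (d j).2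
    have hcol : ∀ j, ratCol (Matrix.of fun i j => N j i) j =
        algebraMap ℂ[X] (RatFunc ℂ) (d j) • (b j : κ → RatFunc ℂ) := fun j => by
      ext i
      simp [ratCol, toRat, hN, Algebra.smul_def]
    have hspan : Submodule.span (RatFunc ℂ) (Set.range fun j => (b j : κ → RatFunc ℂ)) =
        rightNullspace P := by
      have := congrArg (Submodule.map (rightNullspace P).subtype) b.span_eq
      rw [Submodule.map_span, ← Set.range_comp, Submodule.map_subtype_top] at this
      exact this
    have hle : Submodule.span (RatFunc ℂ) (Set.range fun j => (b j : κ → RatFunc ℂ)) ≤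
        Submodule.span (RatFunc ℂ) (Set.range (ratCol (Matrix.of fun i j => N j i))) := by
      rw [Submodule.span_le]
      rintro _ ⟨j, rfl⟩
      change (b j : κ → RatFunc ℂ) ∈ _
      rw [← inv_smul_smul₀ (hne j) (b j : κ → RatFunc ℂ), ← hcol j]
      exact Submodule.smul_mem _ _ (Submodule.subset_span ⟨j, rfl⟩)
    refine ⟨Matrix.of fun i j => N j i, linearIndependent_of_span_le hb hle,
      le_antisymm ?_ (hspan ▸ hle)⟩
    rw [Submodule.span_le]
    rintro _ ⟨j, rfl⟩
    rw [hcol j]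
    exact Submodule.smul_mem _ _ (b j).2
  let f : Matrix κ (Fin p) ℂ[X] → ℕ := fun N => ∑ j, colDegree fun i => N i j
  refine ⟨p, Function.argminOn f S hS, (Function.argminOn_mem f S hS).1,
    (Function.argminOn_mem f S hS).2, fun M h1 h2 => ?_⟩
  exact Function.argminOn_le f S (a := M) ⟨h1, h2⟩

theorem natDegree_le_colDegree {κ : Type*} [Fintype κ] (v : κ → ℂ[X]) (i : κ) :
    (v i).natDegree ≤ colDegree v :=
  Finset.le_sup (f := fun i => (v i).natDegree) (Finset.mem_univ i)

theorem IsMinimalBasis.linearIndependent_evalCol {ι κ : Type*} [Fintype ι] [Fintype κ]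
    {P : Matrix ι κ ℂ[X]} {p : ℕ} {N : Matrix κ (Fin p) ℂ[X]} (hN : IsMinimalBasis P N)
    (μ : ℂ) : LinearIndependent ℂ (evalCol N μ) := by
  classical
  obtain ⟨hli, hspan, hmin⟩ := hN
  change LinearIndependent (RatFunc ℂ) (ratCol N) at hli
  change Submodule.span (RatFunc ℂ) (Set.range (ratCol N)) = rightNullspace P at hspan
  rw [Fintype.linearIndependent_iff]
  intro c hc
  by_contra! hne
  obtain ⟨j₀, hj₀, hmax⟩ := Finset.exists_max_image (Finset.univ.filter fun j => c j ≠ 0)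
    (fun j => colDegree fun i => N i j) (by simpa [Finset.filter_nonempty_iff] using hne)
  simp only [Finset.mem_filter, Finset.mem_univ, true_and] at hj₀ hmax
  set D := colDegree fun i => N i j₀ with hD
  let y : κ → ℂ[X] := fun i => ∑ j, C (c j) * N i j
  have hy0 : evalVec y μ = 0 := by
    ext i
    have := congrFun hc i
    simpa [evalVec, evalCol, y, eval_finsetSum] using this
  choose z hz using (evalVec_eq_zero_iff y μ).1 hy0
  let a : Fin p → RatFunc ℂ := fun j => algebraMap ℂ[X] (RatFunc ℂ) (C (c j))
  let τ : RatFunc ℂ := algebraMap ℂ[X] (RatFunc ℂ) (X - C μ)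
  have ha₀ : a j₀ ≠ 0 := by simpa [a] using hj₀
  have hτ : τ ≠ 0 := by
    rw [Ne, FaithfulSMul.algebraMap_eq_zero_iff]
    exact X_sub_C_ne_zero μ
  let zr : κ → RatFunc ℂ := fun i => algebraMap ℂ[X] (RatFunc ℂ) (z i)
  have hrel : τ • zr = ∑ j, a j • ratCol N j := by
    ext i
    have := congrArg (algebraMap ℂ[X] (RatFunc ℂ)) (hz i)
    simp only [y, map_sum, map_mul] at this
    simpa [τ, zr, a, ratCol, toRat] using this.symm
  have hydeg : ∀ i, (y i).natDegree ≤ D := fun i => by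
    refine natDegree_sum_le_of_forall_le _ _ fun j _ => ?_
    by_cases h : c j = 0
    · simp [h]
    · exact (natDegree_C_mul_le _ _).trans
        ((natDegree_le_colDegree (fun i => N i j) i).trans (hmax j h))
  have hzdeg : ∀ i, z i ≠ 0 → (z i).natDegree + 1 ≤ D := fun i hi => by
    have := hydeg i
    rw [hz i, natDegree_mul (X_sub_C_ne_zero μ) hi, natDegree_X_sub_C] at this
    omega
  have hDpos : 0 < D := by
    by_contra h
    have hz0 : zr = 0 := by
      ext i
      by_contra hi
      have := hzdeg i fun h => hi (by simp [zr, h])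
      omega
    rw [hz0, smul_zero] at hrel
    exact ha₀ (Fintype.linearIndependent_iff.1 hli a hrel.symm j₀)
  let M := N.updateCol j₀ z
  have hM₀ : ratCol M j₀ = zr := by
    ext i
    simp [ratCol, toRat, M, zr]
  have hM : ∀ j, j ≠ j₀ → ratCol M j = ratCol N j := fun j hj => by
    ext i
    simp [ratCol, toRat, M, hj]
  have hle : Submodule.span (RatFunc ℂ) (Set.range (ratCol N)) ≤
      Submodule.span (RatFunc ℂ) (Set.range (ratCol M)) := by
    have hmem : ∀ j, ratCol M j ∈ Submodule.span (RatFunc ℂ) (Set.range (ratCol M)) :=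
      fun j => Submodule.subset_span ⟨j, rfl⟩
    rw [Submodule.span_le]
    rintro _ ⟨j, rfl⟩
    by_cases hj : j = j₀
    · subst hj
      have h1 : a j • ratCol N j = τ • ratCol M j -
          ∑ i ∈ Finset.univ.erase j, a i • ratCol M i := by
        rw [hM₀, hrel, ← Finset.add_sum_erase _ _ (Finset.mem_univ j), Finset.sum_congr rfl
          fun i hi => by rw [← hM i (Finset.ne_of_mem_erase hi)]]
        simp
      rw [SetLike.mem_coe, ← inv_smul_smul₀ ha₀ (ratCol N j), h1]
      exact Submodule.smul_mem _ _ (Submodule.sub_mem _ (Submodule.smul_mem _ _ (hmem j))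
        (Submodule.sum_mem _ fun i _ => Submodule.smul_mem _ _ (hmem i)))
    · rw [← hM j hj]
      exact hmem j
  have hge : Submodule.span (RatFunc ℂ) (Set.range (ratCol M)) ≤
      Submodule.span (RatFunc ℂ) (Set.range (ratCol N)) := by
    have hmem : ∀ j, ratCol N j ∈ Submodule.span (RatFunc ℂ) (Set.range (ratCol N)) :=
      fun j => Submodule.subset_span ⟨j, rfl⟩
    rw [Submodule.span_le]
    rintro _ ⟨j, rfl⟩
    by_cases hj : j = j₀
    · rw [hj, hM₀, SetLike.mem_coe, ← inv_smul_smul₀ hτ zr, hrel]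
      exact Submodule.smul_mem _ _
        (Submodule.sum_mem _ fun i _ => Submodule.smul_mem _ _ (hmem i))
    · rw [hM j hj]
      exact hmem j
  refine (hmin M (linearIndependent_of_span_le hli hle)
    ((le_antisymm hge hle).trans hspan)).not_gt ?_
  refine Finset.sum_lt_sum (fun j _ => ?_) ⟨j₀, Finset.mem_univ _, ?_⟩
  all_goals
    have hz' : colDegree z < D := (Finset.sup_lt_iff hDpos).2 fun i _ => by
      by_cases hi : z i = 0
      · simpa [hi] using hDpos
      · exact hzdeg i hi
  · by_cases hj : j = j₀
    · subst hj
      simpa [M] using hz'.le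
    · simp [M, hj]
  · simpa [M] using hz'

/-- The vectors `w` are linearly independent, together with the value at `μ` of every right
minimal basis of `P`. -/
def IndepAt {ι κ : Type*} [Fintype ι] [Fintype κ] (P : Matrix ι κ ℂ[X]) (μ : ℂ) {s : ℕ}
    (w : Fin s → κ → ℂ) : Prop :=
  ∀ (p : ℕ) (N : Matrix κ (Fin p) ℂ[X]), IsMinimalBasis P N →
    LinearIndependent ℂ (Sum.elim (evalCol N μ) w)

theorem rank_of_eq_card_iff {κ α : Type*} [Fintype κ] [Fintype α] (f : α → κ → ℂ) :
    (Matrix.of fun i j => f j i).rank = Fintype.card α ↔ LinearIndependent ℂ f := by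
  rw [linearIndependent_iff_card_eq_finrank_span, Matrix.rank_eq_finrank_span_cols, eq_comm]
  rfl

theorem indepAt_iff_rank {ι κ : Type*} [Fintype ι] [Fintype κ] (P : Matrix ι κ ℂ[X]) (μ : ℂ)
    {s : ℕ} (w : Fin s → κ → ℂ) :
    (∀ (p : ℕ) (N : Matrix κ (Fin p) ℂ[X]), IsMinimalBasis P N →
      (Matrix.of fun (i : κ) (j : Sum (Fin p) (Fin s)) =>
        Sum.elim (fun a => (N i a).eval μ) (fun b => w b i) j).rank = p + s) ↔
      IndepAt P μ w := by
  refine forall₃_congr fun p N _ => ?_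
  rw [← rank_of_eq_card_iff, Fintype.card_sum, Fintype.card_fin, Fintype.card_fin]
  have : (Matrix.of fun (i : κ) (j : Sum (Fin p) (Fin s)) =>
      Sum.elim (fun a => (N i a).eval μ) (fun b => w b i) j) =
      Matrix.of fun i j => Sum.elim (evalCol N μ) w j i := by
    ext i (j | j) <;> rfl
  rw [this]

theorem isRootPoly_iff {ι κ : Type*} [Fintype ι] [Fintype κ] (P : Matrix ι κ ℂ[X]) (μ : ℂ)
    (k : ℕ) (x : κ → ℂ[X]) : IsRootPoly P μ k x ↔
      IsZeroDirection P μ k x ∧ IndepAt P μ fun _ : Fin 1 => evalVec x μ := by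
  rw [← indepAt_iff_rank]
  rfl

/-- The first `j` vectors of `w`, followed by `x`. -/
def initSnoc {V : Type*} {s : ℕ} (w : Fin s → V) (j : Fin s) (x : V) : Fin (j + 1) → V :=
  fun b => if h : (b : ℕ) < j then w ⟨b, h.trans j.isLt⟩ else x

theorem comp_initSnoc {V W : Type*} {s : ℕ} (f : V → W) (w : Fin s → V) (j : Fin s) (x : V) :
    (fun b => f (initSnoc w j x b)) = initSnoc (fun i => f (w i)) j (f x) := by
  ext1 b
  exact apply_dite f _ _ _

theorem isIndepFamily_iff {ι κ : Type*} [Fintype ι] [Fintype κ] (P : Matrix ι κ ℂ[X]) (μ : ℂ)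
    {s : ℕ} (k : Fin s → ℕ) (r : Fin s → κ → ℂ[X]) : IsIndepFamily P μ k r ↔
      (∀ i, IsRootPoly P μ (k i) (r i)) ∧ IndepAt P μ fun i => evalVec (r i) μ := by
  rw [← indepAt_iff_rank]
  rfl

theorem isMaximalFamily_iff {ι κ : Type*} [Fintype ι] [Fintype κ] (P : Matrix ι κ ℂ[X]) (μ : ℂ)
    {s : ℕ} (k : Fin s → ℕ) (r : Fin s → κ → ℂ[X]) : IsMaximalFamily P μ k r ↔
      IsCompleteFamily P μ k r ∧ Antitone k ∧ (∀ i, 0 < k i) ∧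
      ∀ (j : Fin s) (k' : ℕ), k j < k' → ∀ x : κ → ℂ[X], IsRootPoly P μ k' x →
        ¬ IndepAt P μ (initSnoc (fun i => evalVec (r i) μ) j (evalVec x μ)) := by
  unfold IsMaximalFamily
  refine and_congr_right fun _ => and_congr_right fun _ => and_congr_right fun _ =>
    forall₅_congr fun j k' _ x _ => ?_
  rw [← indepAt_iff_rank]
  refine not_congr (forall₃_congr fun p N _ => ?_)
  rw [add_assoc, iff_iff_eq]
  congr 2
  ext i (a | b)
  · rfl
  · change (if h : (b : ℕ) < (j : ℕ) then (r ⟨(b : ℕ), h.trans j.isLt⟩ i).eval μ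
      else (x i).eval μ) = initSnoc (fun i => evalVec (r i) μ) j (evalVec x μ) b i
    unfold initSnoc
    split_ifs <;> rfl

theorem IsZeroDirection.evalMat_mulVec {ι κ : Type*} [Fintype κ] {P : Matrix ι κ ℂ[X]} {μ : ℂ}
    {k : ℕ} {x : κ → ℂ[X]} (h : IsZeroDirection P μ k x) : evalMat P μ *ᵥ evalVec x μ = 0 := by
  rw [← evalVec_mulVec, evalVec_eq_zero_iff]
  exact fun i => (dvd_pow_self _ h.1.ne').trans (h.2.2.1 i)

end RootPolynomials

section Regular

variable {m : ℕ} {Rm : Matrix (Fin m) (Fin m) ℂ[X]}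

theorem indepAt_regular_iff (hdet : Rm.det ≠ 0) (μ : ℂ) {s : ℕ} (w : Fin s → Fin m → ℂ) :
    IndepAt Rm μ w ↔ LinearIndependent ℂ w := by
  constructor
  · intro h
    obtain ⟨p, N, hN⟩ := exists_isMinimalBasis Rm
    exact (linearIndependent_sum.1 (h p N hN)).2.1
  · intro h p N hN
    have hp : IsEmpty (Fin p) := by
      refine ⟨fun j => hN.1.ne_zero j ?_⟩
      have h1 := Matrix.eq_zero_of_mulVec_eq_zero hdet (mulVec_col_of_span_eq hN.2.1 j)
      ext i
      simpa [toRat] using congrFun h1 i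
    refine linearIndependent_sum.2 ⟨linearIndependent_empty_type, h, ?_⟩
    have : Set.range (Sum.elim (evalCol N μ) w ∘ Sum.inl) = ∅ := Set.range_eq_empty _
    rw [this, Submodule.span_empty]
    exact disjoint_bot_left

theorem isRootPoly_regular_iff (hdet : Rm.det ≠ 0) (μ : ℂ) (k : ℕ) (x : Fin m → ℂ[X]) :
    IsRootPoly Rm μ k x ↔ IsZeroDirection Rm μ k x := by
  rw [isRootPoly_iff, indepAt_regular_iff hdet, linearIndependent_unique_iff]
  exact and_iff_left_of_imp fun h => h.2.1

end Regular

section BlockTriangular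

variable {m1 m2 m3 n1 n3 : ℕ} {lam0 : ℂ}
  {Ll : Matrix (Fin m1) (Fin n1) ℂ[X]} {Am : Matrix (Fin m1) (Fin m2) ℂ[X]}
  {Bm : Matrix (Fin m1) (Fin n3) ℂ[X]} {Rm : Matrix (Fin m2) (Fin m2) ℂ[X]}
  {Cm : Matrix (Fin m2) (Fin n3) ℂ[X]} {Lr : Matrix (Fin m3) (Fin n3) ℂ[X]}
  {Rinv : Matrix (Fin n1) (Fin m1) ℂ[X]}

/-- The first block of a vector. -/
def topBlock {K : Type*} (x : Fin n1 ⊕ Fin m2 ⊕ Fin n3 → K) : Fin n1 → K := fun a => x (.inl a)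

/-- The second block of a vector. -/
def midBlock {K : Type*} (x : Fin n1 ⊕ Fin m2 ⊕ Fin n3 → K) : Fin m2 → K :=
  fun a => x (.inr (.inl a))

/-- The third block of a vector. -/
def botBlock {K : Type*} (x : Fin n1 ⊕ Fin m2 ⊕ Fin n3 → K) : Fin n3 → K :=
  fun a => x (.inr (.inr a))

/-- The second block of a vector, as a linear map. -/
def midBlockₗ : (Fin n1 ⊕ Fin m2 ⊕ Fin n3 → ℂ) →ₗ[ℂ] (Fin m2 → ℂ) :=
  LinearMap.funLeft ℂ ℂ fun a => .inr (.inl a)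

/-- The inclusion of the first block. -/
def topIncl (K : Type*) [Field K] (n1 m2 n3 : ℕ) :
    (Fin n1 → K) →ₗ[K] (Fin n1 ⊕ Fin m2 ⊕ Fin n3 → K) where
  toFun x := Sum.elim x 0
  map_add' x y := by ext (i | i) <;> simp
  map_smul' c x := by ext (i | i) <;> simp

theorem blockTri_mulVec (x : Fin n1 ⊕ Fin m2 ⊕ Fin n3 → ℂ[X]) :
    blockTri Ll Am Bm Rm Cm Lr *ᵥ x =
      Sum.elim (Ll *ᵥ topBlock x + Am *ᵥ midBlock x + Bm *ᵥ botBlock x)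
        (Sum.elim (Rm *ᵥ midBlock x + Cm *ᵥ botBlock x) (Lr *ᵥ botBlock x)) := by
  ext1 (i | i | i) <;>
    simp [blockTri, mulVec, dotProduct, Fintype.sum_sum_type, topBlock, midBlock, botBlock,
      add_assoc]

theorem evalMat_blockTri_mulVec (x : Fin n1 ⊕ Fin m2 ⊕ Fin n3 → ℂ) :
    evalMat (blockTri Ll Am Bm Rm Cm Lr) lam0 *ᵥ x =
      Sum.elim (evalMat Ll lam0 *ᵥ topBlock x + evalMat Am lam0 *ᵥ midBlock x +
          evalMat Bm lam0 *ᵥ botBlock x)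
        (Sum.elim (evalMat Rm lam0 *ᵥ midBlock x + evalMat Cm lam0 *ᵥ botBlock x)
          (evalMat Lr lam0 *ᵥ botBlock x)) := by
  ext1 (i | i | i) <;>
    simp [blockTri, evalMat, mulVec, dotProduct, Fintype.sum_sum_type, topBlock, midBlock,
      botBlock, add_assoc]

theorem toRat_blockTri_mulVec_topIncl (x : Fin n1 → RatFunc ℂ) :
    toRat (blockTri Ll Am Bm Rm Cm Lr) *ᵥ topIncl _ n1 m2 n3 x =
      topIncl _ m1 m2 m3 (toRat Ll *ᵥ x) := by
  ext1 (i | i | i) <;>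
    simp [blockTri, toRat, mulVec, dotProduct, Fintype.sum_sum_type, topIncl]

theorem finrank_ker_eval_le (hinv : Ll * Rinv = 1) :
    Module.finrank ℂ (LinearMap.ker (evalMat Ll lam0).mulVecLin) ≤ n1 - m1 := by
  have hsurj : Function.Surjective (evalMat Ll lam0).mulVecLin := fun y => by
    refine ⟨evalMat Rinv lam0 *ᵥ y, ?_⟩
    have h : evalMat Ll lam0 * evalMat Rinv lam0 = 1 := by
      have := congrArg (evalRingHom lam0).mapMatrix hinv
      rwa [RingHom.mapMatrix_apply, Matrix.map_mul, map_one] at this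
    simp [mulVec_mulVec, h]
  have h1 := LinearMap.finrank_range_add_finrank_ker (evalMat Ll lam0).mulVecLin
  rw [LinearMap.range_eq_top.2 hsurj, finrank_top, Module.finrank_fin_fun,
    Module.finrank_fin_fun] at h1
  omega

theorem le_finrank_rightNullspace :
    n1 - m1 ≤ Module.finrank (RatFunc ℂ) (rightNullspace (blockTri Ll Am Bm Rm Cm Lr)) := by
  have h1 := LinearMap.finrank_range_add_finrank_ker (toRat Ll).mulVecLin
  have h2 := Submodule.finrank_le (LinearMap.range (toRat Ll).mulVecLin)
  rw [Module.finrank_fin_fun] at h1 h2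
  have hinj : Function.Injective (topIncl (RatFunc ℂ) n1 m2 n3) := fun x y h => by
    ext1 i
    exact congrFun h (.inl i)
  have hle : (LinearMap.ker (toRat Ll).mulVecLin).map (topIncl (RatFunc ℂ) n1 m2 n3) ≤
      rightNullspace (blockTri Ll Am Bm Rm Cm Lr) := by
    rintro _ ⟨x, hx, rfl⟩
    have hx' : toRat Ll *ᵥ x = 0 := hx
    change toRat (blockTri Ll Am Bm Rm Cm Lr) *ᵥ _ = 0
    rw [toRat_blockTri_mulVec_topIncl, hx', map_zero]
  have h3 := Submodule.finrank_mono hle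
  rw [← (Submodule.equivMapOfInjective _ hinj _).finrank_eq] at h3
  omega

theorem midBlock_eq_zero_of_mulVec_eq_zero (hdet : Rm.det ≠ 0)
    (hLr : Function.Injective (evalMat Lr lam0).mulVec) {x : Fin n1 ⊕ Fin m2 ⊕ Fin n3 → ℂ[X]}
    (h : blockTri Ll Am Bm Rm Cm Lr *ᵥ x = 0) : midBlock x = 0 := by
  rw [blockTri_mulVec] at h
  have h3 : Lr *ᵥ botBlock x = 0 := funext fun i => congrFun h (.inr (.inr i))
  have hbot : botBlock x = 0 := by
    by_contra hne
    obtain ⟨k, -, -, hk'⟩ := exists_exact_order hne (μ := lam0) (k := 0) (by simp)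
    exact hk' (pow_dvd_of_pow_dvd_mulVec hLr _ _ (by simp [h3]))
  have h2 : Rm *ᵥ midBlock x + Cm *ᵥ botBlock x = 0 :=
    funext fun i => congrFun h (.inr (.inl i))
  rw [hbot, mulVec_zero, add_zero] at h2
  exact Matrix.eq_zero_of_mulVec_eq_zero hdet h2

theorem span_evalCol_minimalBasis (hinv : Ll * Rinv = 1) (hdet : Rm.det ≠ 0)
    (hLr : Function.Injective (evalMat Lr lam0).mulVec) {p : ℕ}
    {N : Matrix (Fin n1 ⊕ Fin m2 ⊕ Fin n3) (Fin p) ℂ[X]}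
    (hN : IsMinimalBasis (blockTri Ll Am Bm Rm Cm Lr) N) :
    Submodule.span ℂ (Set.range (evalCol N lam0)) =
      LinearMap.ker midBlockₗ ⊓
        LinearMap.ker (evalMat (blockTri Ll Am Bm Rm Cm Lr) lam0).mulVecLin := by
  apply Submodule.eq_of_le_of_finrank_le
  · rw [Submodule.span_le]
    rintro _ ⟨j, rfl⟩
    have h0 := mulVec_col_of_span_eq hN.2.1 j
    refine ⟨?_, ?_⟩
    · have h1 := midBlock_eq_zero_of_mulVec_eq_zero hdet hLr h0
      change midBlockₗ (evalCol N lam0 j) = 0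
      ext i
      have h2 : N (.inr (.inl i)) j = 0 := congrFun h1 i
      simp [midBlockₗ, LinearMap.funLeft, evalCol, h2]
    · change evalMat (blockTri Ll Am Bm Rm Cm Lr) lam0 *ᵥ evalVec (fun i => N i j) lam0 = 0
      rw [← evalVec_mulVec, h0]
      ext i
      simp [evalVec]
  · rw [finrank_span_eq_card (hN.linearIndependent_evalCol lam0)]
    have hp : Module.finrank (RatFunc ℂ) (rightNullspace (blockTri Ll Am Bm Rm Cm Lr)) =
        Fintype.card (Fin p) := by
      rw [← hN.2.1]
      exact finrank_span_eq_card hN.1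
    rw [← hp]
    refine le_trans ?_ ((finrank_ker_eval_le (lam0 := lam0) hinv).trans
      le_finrank_rightNullspace)
    refine le_trans (Submodule.finrank_mono ?_)
      (Submodule.finrank_map_le (topIncl ℂ n1 m2 n3) _)
    rintro x ⟨hmid, hx⟩
    have hmid' : midBlock x = 0 := hmid
    have hx' : evalMat (blockTri Ll Am Bm Rm Cm Lr) lam0 *ᵥ x = 0 := hx
    rw [evalMat_blockTri_mulVec] at hx'
    have hbot : botBlock x = 0 := hLr <| by
      rw [mulVec_zero]
      exact funext fun i => congrFun hx' (.inr (.inr i))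
    refine ⟨topBlock x, ?_, ?_⟩
    · change evalMat Ll lam0 *ᵥ topBlock x = 0
      ext1 i
      simpa [hmid', hbot] using congrFun hx' (.inl i)
    · ext1 (i | i | i)
      · rfl
      · exact (congrFun hmid' i).symm
      · exact (congrFun hbot i).symm

theorem indepAt_blockTri_iff (hinv : Ll * Rinv = 1) (hdet : Rm.det ≠ 0)
    (hLr : Function.Injective (evalMat Lr lam0).mulVec) {s : ℕ}
    (w : Fin s → Fin n1 ⊕ Fin m2 ⊕ Fin n3 → ℂ)
    (hw : ∀ i, evalMat (blockTri Ll Am Bm Rm Cm Lr) lam0 *ᵥ w i = 0) :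
    IndepAt (blockTri Ll Am Bm Rm Cm Lr) lam0 w ↔
      LinearIndependent ℂ fun i => midBlock (w i) := by
  have hspan : Submodule.span ℂ (Set.range w) ≤
      LinearMap.ker (evalMat (blockTri Ll Am Bm Rm Cm Lr) lam0).mulVecLin := by
    rw [Submodule.span_le]
    rintro _ ⟨i, rfl⟩
    exact hw i
  constructor
  · intro h
    obtain ⟨p, N, hN⟩ := exists_isMinimalBasis (blockTri Ll Am Bm Rm Cm Lr)
    obtain ⟨-, h2, h3⟩ := linearIndependent_sum.1 (h p N hN)
    refine h2.map (f := midBlockₗ) ?_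
    rw [Submodule.disjoint_def] at h3 ⊢
    intro x hx hmid
    refine h3 x ?_ hx
    change x ∈ Submodule.span ℂ (Set.range (evalCol N lam0))
    rw [span_evalCol_minimalBasis hinv hdet hLr hN]
    exact ⟨hmid, hspan hx⟩
  · intro h p N hN
    refine linearIndependent_sum.2 ⟨hN.linearIndependent_evalCol lam0,
      LinearIndependent.of_comp midBlockₗ h, ?_⟩
    rw [Submodule.disjoint_def]
    intro x hx hx'
    change x ∈ Submodule.span ℂ (Set.range (evalCol N lam0)) at hx
    rw [span_evalCol_minimalBasis hinv hdet hLr hN] at hx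
    obtain ⟨c, rfl⟩ := (Submodule.mem_span_range_iff_exists_fun ℂ).1 hx'
    have h0 : midBlockₗ (∑ i, c i • (Sum.elim (evalCol N lam0) w ∘ Sum.inr) i) = 0 := hx.1
    rw [map_sum] at h0
    simp only [map_smul] at h0
    have hc := Fintype.linearIndependent_iff.1 h c h0
    simp [hc]

theorem isRootPoly_blockTri_iff (hinv : Ll * Rinv = 1) (hdet : Rm.det ≠ 0)
    (hLr : Function.Injective (evalMat Lr lam0).mulVec) {k : ℕ}
    {q : Fin n1 ⊕ Fin m2 ⊕ Fin n3 → ℂ[X]} :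
    IsRootPoly (blockTri Ll Am Bm Rm Cm Lr) lam0 k q ↔
      IsZeroDirection (blockTri Ll Am Bm Rm Cm Lr) lam0 k q ∧
        evalVec (midBlock q) lam0 ≠ 0 := by
  rw [isRootPoly_iff]
  refine and_congr_right fun h => ?_
  rw [indepAt_blockTri_iff hinv hdet hLr _ fun _ => h.evalMat_mulVec,
    linearIndependent_unique_iff]
  rfl

theorem isRootPoly_midBlock (hdet : Rm.det ≠ 0)
    (hLr : Function.Injective (evalMat Lr lam0).mulVec) {k : ℕ}
    {q : Fin n1 ⊕ Fin m2 ⊕ Fin n3 → ℂ[X]} {v : Fin m2 → ℂ[X]}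
    (hq : IsZeroDirection (blockTri Ll Am Bm Rm Cm Lr) lam0 k q)
    (hv : evalVec v lam0 ≠ 0) (hqv : ∀ i, (X - C lam0) ^ k ∣ v i - midBlock q i) :
    ∃ k', k ≤ k' ∧ IsRootPoly Rm lam0 k' v := by
  have hdvd := hq.2.2.1
  rw [blockTri_mulVec] at hdvd
  have hbot := pow_dvd_of_pow_dvd_mulVec hLr k _ fun i => hdvd (.inr (.inr i))
  have hmul : ∀ {n : ℕ} (M : Matrix (Fin m2) (Fin n) ℂ[X]) (y : Fin n → ℂ[X]),
      (∀ j, (X - C lam0) ^ k ∣ y j) → ∀ i, (X - C lam0) ^ k ∣ (M *ᵥ y) i :=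
    fun M y hy i => Finset.dvd_sum (s := Finset.univ) (f := fun j => M i j * y j)
      fun j _ => (hy j).mul_left _
  have hR : ∀ i, (X - C lam0) ^ k ∣ (Rm *ᵥ v) i := fun i => by
    have h1 : (X - C lam0) ^ k ∣ (Rm *ᵥ midBlock q + Cm *ᵥ botBlock q) i :=
      hdvd (.inr (.inl i))
    have h2 := (dvd_add_left (hmul Cm _ hbot i)).1 h1
    have h3 := hmul Rm (v - midBlock q) hqv i
    rw [mulVec_sub, Pi.sub_apply] at h3
    exact (dvd_sub_left h2).1 h3
  have hne : Rm *ᵥ v ≠ 0 := fun h => hv <| by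
    rw [Matrix.eq_zero_of_mulVec_eq_zero hdet h]
    ext i
    simp [evalVec]
  obtain ⟨k', hkk', h1, h2⟩ := exists_exact_order hne hR
  exact ⟨k', hkk', (isRootPoly_regular_iff hdet _ _ _).2 ⟨hq.1.trans_le hkk', hv, h1, h2⟩⟩

/-- The lift `[-Rinv A v; v; 0]` of `v` to the block triangular matrix. -/
def blockLift (n3 : ℕ) (Rinv : Matrix (Fin n1) (Fin m1) ℂ[X]) (Am : Matrix (Fin m1) (Fin m2) ℂ[X])
    (v : Fin m2 → ℂ[X]) : Fin n1 ⊕ Fin m2 ⊕ Fin n3 → ℂ[X] :=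
  Sum.elim (-(Rinv *ᵥ (Am *ᵥ v))) (Sum.elim v fun _ => 0)

theorem blockTri_mulVec_blockLift (hinv : Ll * Rinv = 1) (v : Fin m2 → ℂ[X]) :
    blockTri Ll Am Bm Rm Cm Lr *ᵥ blockLift n3 Rinv Am v =
      Sum.elim (0 : Fin m1 → ℂ[X]) (Sum.elim (Rm *ᵥ v) (0 : Fin m3 → ℂ[X])) := by
  have h1 : topBlock (blockLift n3 Rinv Am v) = -(Rinv *ᵥ (Am *ᵥ v)) := rfl
  have h2 : midBlock (blockLift n3 Rinv Am v) = v := rfl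
  have h3 : botBlock (blockLift n3 Rinv Am v) = 0 := rfl
  rw [blockTri_mulVec, h1, h2, h3, mulVec_neg, mulVec_mulVec, hinv]
  simp

theorem isRootPoly_blockLift (hinv : Ll * Rinv = 1) (hdet : Rm.det ≠ 0)
    (hLr : Function.Injective (evalMat Lr lam0).mulVec) {k : ℕ} {v : Fin m2 → ℂ[X]}
    (hv : IsRootPoly Rm lam0 k v) :
    IsRootPoly (blockTri Ll Am Bm Rm Cm Lr) lam0 k (blockLift n3 Rinv Am v) := by
  obtain ⟨hk, hv0, h1, h2⟩ := hv.1
  refine (isRootPoly_blockTri_iff hinv hdet hLr).2 ⟨⟨hk, fun h => hv0 ?_, ?_, fun h => h2 ?_⟩, hv0⟩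
  · exact funext fun i => congrFun h (.inr (.inl i))
  · rw [blockTri_mulVec_blockLift hinv]
    rintro (i | i | i)
    · exact dvd_zero _
    · exact h1 i
    · exact dvd_zero _
  · rw [blockTri_mulVec_blockLift hinv] at h
    exact fun i => h (.inr (.inl i))

theorem indepAt_evalVec_iff (hinv : Ll * Rinv = 1) (hdet : Rm.det ≠ 0)
    (hLr : Function.Injective (evalMat Lr lam0).mulVec) {s : ℕ} {k : Fin s → ℕ}
    {q : Fin s → Fin n1 ⊕ Fin m2 ⊕ Fin n3 → ℂ[X]}
    (hq : ∀ i, IsRootPoly (blockTri Ll Am Bm Rm Cm Lr) lam0 (k i) (q i)) :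
    IndepAt (blockTri Ll Am Bm Rm Cm Lr) lam0 (fun i => evalVec (q i) lam0) ↔
      IndepAt Rm lam0 fun i => evalVec (midBlock (q i)) lam0 := by
  rw [indepAt_blockTri_iff hinv hdet hLr _ fun i => (hq i).1.evalMat_mulVec,
    indepAt_regular_iff hdet]
  rfl

theorem indepAt_initSnoc_iff (hinv : Ll * Rinv = 1) (hdet : Rm.det ≠ 0)
    (hLr : Function.Injective (evalMat Lr lam0).mulVec) {s : ℕ} {k : Fin s → ℕ}
    {q : Fin s → Fin n1 ⊕ Fin m2 ⊕ Fin n3 → ℂ[X]}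
    (hq : ∀ i, IsRootPoly (blockTri Ll Am Bm Rm Cm Lr) lam0 (k i) (q i)) (j : Fin s) {k' : ℕ}
    {x : Fin n1 ⊕ Fin m2 ⊕ Fin n3 → ℂ[X]}
    (hx : IsRootPoly (blockTri Ll Am Bm Rm Cm Lr) lam0 k' x) :
    IndepAt (blockTri Ll Am Bm Rm Cm Lr) lam0
        (initSnoc (fun i => evalVec (q i) lam0) j (evalVec x lam0)) ↔
      IndepAt Rm lam0 (initSnoc (fun i => evalVec (midBlock (q i)) lam0) j
        (evalVec (midBlock x) lam0)) := by
  rw [← comp_initSnoc (fun y => evalVec y lam0),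
    ← comp_initSnoc (fun y => evalVec (midBlock y) lam0)]
  refine indepAt_evalVec_iff hinv hdet hLr (k := initSnoc k j k') fun b => ?_
  unfold initSnoc
  split_ifs
  exacts [hq _, hx]

theorem IsMaximalFamily.blockLift (hinv : Ll * Rinv = 1) (hdet : Rm.det ≠ 0)
    (hLr : Function.Injective (evalMat Lr lam0).mulVec) {s : ℕ} {k : Fin s → ℕ}
    {v : Fin s → Fin m2 → ℂ[X]} (hv : IsMaximalFamily Rm lam0 k v) :
    IsMaximalFamily (blockTri Ll Am Bm Rm Cm Lr) lam0 k
      fun i => blockLift n3 Rinv Am (v i) := by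
  rw [isMaximalFamily_iff] at hv ⊢
  obtain ⟨⟨hind, hcomp⟩, hanti, hpos, hmax⟩ := hv
  rw [isIndepFamily_iff] at hind
  have hroot : ∀ i, IsRootPoly (blockTri Ll Am Bm Rm Cm Lr) lam0 (k i)
      (_root_.blockLift n3 Rinv Am (v i)) :=
    fun i => isRootPoly_blockLift hinv hdet hLr (hind.1 i)
  have hproj : ∀ {k' : ℕ} {x : Fin n1 ⊕ Fin m2 ⊕ Fin n3 → ℂ[X]},
      IsRootPoly (blockTri Ll Am Bm Rm Cm Lr) lam0 k' x →
      ∃ k'', k' ≤ k'' ∧ IsRootPoly Rm lam0 k'' (midBlock x) := fun hx =>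
    isRootPoly_midBlock hdet hLr hx.1 ((isRootPoly_blockTri_iff hinv hdet hLr).1 hx).2
      (by simp)
  refine ⟨⟨?_, fun s' k' r' h => ?_⟩, hanti, hpos, fun j k' hk' x hx hx' => ?_⟩
  · exact (isIndepFamily_iff _ _ _ _).2
      ⟨hroot, (indepAt_evalVec_iff hinv hdet hLr hroot).2 hind.2⟩
  · rw [isIndepFamily_iff] at h
    choose k'' _ hk'' using fun i => hproj (h.1 i)
    exact hcomp s' k'' (fun i => midBlock (r' i))
      ((isIndepFamily_iff _ _ _ _).2 ⟨hk'', (indepAt_evalVec_iff hinv hdet hLr h.1).1 h.2⟩)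
  · obtain ⟨k'', hle, hx''⟩ := hproj hx
    exact hmax j k'' (hk'.trans_le hle) _ hx''
      ((indepAt_initSnoc_iff hinv hdet hLr hroot j hx).1 hx')

theorem IsMaximalFamily.of_blockTri (hinv : Ll * Rinv = 1) (hdet : Rm.det ≠ 0)
    (hLr : Function.Injective (evalMat Lr lam0).mulVec) {s : ℕ} {k : Fin s → ℕ}
    {q : Fin s → Fin n1 ⊕ Fin m2 ⊕ Fin n3 → ℂ[X]} {v : Fin s → Fin m2 → ℂ[X]}
    (hqv : ∀ i a, (X - C lam0) ^ k i ∣ v i a - midBlock (q i) a)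
    (hq : IsMaximalFamily (blockTri Ll Am Bm Rm Cm Lr) lam0 k q) :
    IsMaximalFamily Rm lam0 k v := by
  rw [isMaximalFamily_iff] at hq ⊢
  obtain ⟨⟨hind, hcomp⟩, hanti, hpos, hmax⟩ := hq
  rw [isIndepFamily_iff] at hind
  have hev : ∀ i, evalVec (midBlock (q i)) lam0 = evalVec (v i) lam0 := fun i => by
    ext a
    have := (dvd_pow_self _ (hpos i).ne').trans (hqv i a)
    rw [dvd_iff_isRoot, IsRoot, eval_sub, sub_eq_zero] at this
    exact this.symm
  have hpre : ∀ (j : Fin s) {k' : ℕ} {x : Fin m2 → ℂ[X]}, k j < k' → IsRootPoly Rm lam0 k' x →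
      ¬ IndepAt Rm lam0 (initSnoc (fun i => evalVec (v i) lam0) j (evalVec x lam0)) := by
    intro j k' x hk' hx hx'
    have hlift : IsRootPoly (blockTri Ll Am Bm Rm Cm Lr) lam0 k' (_root_.blockLift n3 Rinv Am x) :=
      isRootPoly_blockLift hinv hdet hLr hx
    refine hmax j k' hk' _ hlift ((indepAt_initSnoc_iff hinv hdet hLr hind.1 j hlift).2 ?_)
    simp only [hev]
    exact hx'
  have hindv : IndepAt Rm lam0 fun i => evalVec (v i) lam0 := by
    simpa only [hev] using (indepAt_evalVec_iff hinv hdet hLr hind.1).1 hind.2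
  have hroot : ∀ i, IsRootPoly Rm lam0 (k i) (v i) := fun i => by
    obtain ⟨k', hle, hk'⟩ := isRootPoly_midBlock hdet hLr (hind.1 i).1
      (hev i ▸ ((isRootPoly_blockTri_iff hinv hdet hLr).1 (hind.1 i)).2) (hqv i)
    rcases hle.eq_or_lt with rfl | hlt
    · exact hk'
    · refine absurd ?_ (hpre i hlt hk')
      rw [indepAt_regular_iff hdet] at hindv ⊢
      have heq : initSnoc (fun i => evalVec (v i) lam0) i (evalVec (v i) lam0) =
          (fun i => evalVec (v i) lam0) ∘ Fin.castLE i.isLt := by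
        ext1 b
        unfold initSnoc
        split_ifs with h
        · rfl
        · have : Fin.castLE i.isLt b = i := Fin.ext (by simp; omega)
          simp [this]
      rw [heq]
      exact hindv.comp _ (Fin.castLE_injective _)
  refine ⟨⟨(isIndepFamily_iff _ _ _ _).2 ⟨hroot, hindv⟩, fun s' k' r' h => ?_⟩, hanti, hpos,
    fun j k' hk' x hx => hpre j hk' hx⟩
  rw [isIndepFamily_iff] at h
  have hlift : ∀ i, IsRootPoly (blockTri Ll Am Bm Rm Cm Lr) lam0 (k' i)
      (_root_.blockLift n3 Rinv Am (r' i)) := fun i => isRootPoly_blockLift hinv hdet hLr (h.1 i)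
  exact hcomp s' k' _ ((isIndepFamily_iff _ _ _ _).2
    ⟨hlift, (indepAt_evalVec_iff hinv hdet hLr hlift).2 h.2⟩)

end BlockTriangular

/-- Theorem: maximal sets of root polynomials of block triangular pencils.
With `L = [[Lℓ, A, B], [0, R, C], [0, 0, Lr]]` as above: `{v_i}` is a maximal set of root
polynomials at `λ₀` for `R`, of orders `ℓ_1, …, ℓ_s`, iff there exists a maximal set of the
same orders for `L` of the form `q_i = [u_i; v_i; 0] + (λ−λ₀)^{ℓ_i} r_i`. Moreover if
`A = 0`, one may take `u_i = 0` in the forward direction. -/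
theorem maximal_set_block_triangular
    {m1 m2 m3 n1 n3 : ℕ} (lam0 : ℂ)
    (Ll : Matrix (Fin m1) (Fin n1) (Polynomial ℂ))
    (Am : Matrix (Fin m1) (Fin m2) (Polynomial ℂ))
    (Bm : Matrix (Fin m1) (Fin n3) (Polynomial ℂ))
    (Rm : Matrix (Fin m2) (Fin m2) (Polynomial ℂ))
    (Cm : Matrix (Fin m2) (Fin n3) (Polynomial ℂ))
    (Lr : Matrix (Fin m3) (Fin n3) (Polynomial ℂ))
    (hLl : IsPencilMat Ll) (hAm : IsPencilMat Am) (hBm : IsPencilMat Bm)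
    (hRm : IsPencilMat Rm) (hCm : IsPencilMat Cm) (hLr : IsPencilMat Lr)
    (hLlinv : ∃ Rinv : Matrix (Fin n1) (Fin m1) (Polynomial ℂ), Ll * Rinv = 1)
    (hRreg : ∃ (c : ℂ) (d : ℕ), c ≠ 0 ∧
      Rm.det = Polynomial.C c * (Polynomial.X - Polynomial.C lam0) ^ d)
    (hLr0 : (evalMat Lr lam0).rank = n3)
    {s : ℕ} (ℓ : Fin s → ℕ) (v : Fin s → Fin m2 → Polynomial ℂ) :
    (IsMaximalFamily Rm lam0 ℓ v ↔
      ∃ (u : Fin s → Fin n1 → Polynomial ℂ)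
        (rr : Fin s → (Fin n1 ⊕ Fin m2 ⊕ Fin n3) → Polynomial ℂ),
        IsMaximalFamily (blockTri Ll Am Bm Rm Cm Lr) lam0 ℓ
          (fun i q => Sum.elim (u i) (Sum.elim (v i) fun _ => 0) q
            + (Polynomial.X - Polynomial.C lam0) ^ ℓ i * rr i q)) ∧
    (Am = 0 → IsMaximalFamily Rm lam0 ℓ v →
      ∃ rr : Fin s → (Fin n1 ⊕ Fin m2 ⊕ Fin n3) → Polynomial ℂ,
        IsMaximalFamily (blockTri Ll Am Bm Rm Cm Lr) lam0 ℓ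
          (fun i q => Sum.elim (fun _ => 0) (Sum.elim (v i) fun _ => 0) q
            + (Polynomial.X - Polynomial.C lam0) ^ ℓ i * rr i q)) := by
  obtain ⟨Rinv, hinv⟩ := hLlinv
  obtain ⟨c, d, hc, hcd⟩ := hRreg
  have hdet : Rm.det ≠ 0 := by
    rw [hcd]
    exact mul_ne_zero (C_ne_zero.2 hc) (pow_ne_zero _ (X_sub_C_ne_zero lam0))
  have hinj := mulVec_injective_of_rank_eq hLr0
  refine ⟨⟨fun h => ⟨fun i => -(Rinv *ᵥ (Am *ᵥ v i)), fun _ _ => 0, ?_⟩, ?_⟩,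
    fun hA h => ⟨fun _ _ => 0, ?_⟩⟩
  · simp only [mul_zero, add_zero]
    exact h.blockLift hinv hdet hinj
  · rintro ⟨u, rr, h⟩
    refine h.of_blockTri hinv hdet hinj fun i a => ?_
    simp [midBlock]
  · subst hA
    simp only [mul_zero, add_zero]
    convert h.blockLift (Am := 0) hinv hdet hinj using 2 with i
    rw [blockLift, zero_mulVec, mulVec_zero, neg_zero]
    rfl

end
end

section
/- Let A_ε+λE_ε∈ℂ[λ]^{m×n} be the block bidiagonal pencil of the assumed form, with Z_i=[0 −A_{i,i+1}^{−1}Ê_{i,i}]∈ℂ^{s_i×t_i}. Let A_ε^†∈ℂ^{n×m} be the block matrix whose (i+1,i) block equals A_{i,i+1}^{−1} (i=1,…,k−1) and whose other blocks are zero, and let Z∈ℂ^{n×n} be the block matrix whose (i+1,i) block equals Z_i (i=1,…,k−1) and whose other blocks are zero. Then: (i) A_ε A_ε^† = I_m; (ii) Z=−A_ε^†E_ε and Z is nilpotent with Z^k=0; (iii) R(λ)=(Σ_{i=0}^{k−1} λ^i Z^i) A_ε^† is a polynomial right inverse of the pencil, i.e., (A_ε+λE_ε)R(λ)=I_m. 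-/
open Polynomial Matrix

noncomputable section

/-- Pad an `s_i × s_i` matrix (`s_i = t (i+1)`) with `t i − t (i+1)` zero columns on the
left, producing an `s_i × t_i` matrix `[0 M]`. -/
def padColsLeft (t : ℕ → ℕ) (i : ℕ) (M : Matrix (Fin (t (i+1))) (Fin (t (i+1))) ℂ) :
    Matrix (Fin (t (i+1))) (Fin (t i)) ℂ :=
  Matrix.of fun a b =>
    if h : (b : ℕ) < t i - t (i+1) then 0
    else M a ⟨(b : ℕ) - (t i - t (i+1)), by have hb := b.isLt; omega⟩

/-- `Z_i = [0 −A_{i,i+1}⁻¹ Ê_{i,i}]`, the unique solution of `A_{i,i+1} Z_i + E_{i,i} = 0`. -/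
def Zblk (t : ℕ → ℕ) (A Ehat : ∀ i : ℕ, Matrix (Fin (t (i+1))) (Fin (t (i+1))) ℂ) (i : ℕ) :
    Matrix (Fin (t (i+1))) (Fin (t i)) ℂ :=
  padColsLeft t i (-((A i)⁻¹ * Ehat i))

/-- The constant term `A_ε` of the block bidiagonal pencil: block `(i, i+1)` equals
`A_{i,i+1}`, all other blocks vanish. -/
def bidiagA (k : ℕ) (t : ℕ → ℕ)
    (A : ∀ i : ℕ, Matrix (Fin (t (i+1))) (Fin (t (i+1))) ℂ) :
    Matrix (Σ i : Fin (k-1), Fin (t ((i : ℕ)+1))) (Σ j : Fin k, Fin (t (j : ℕ))) ℂ :=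
  Matrix.of fun p q =>
    if h : (q.1 : ℕ) = (p.1 : ℕ) + 1 then A (p.1 : ℕ) p.2 (Fin.cast (congrArg t h) q.2)
    else 0

/-- The coefficient `E_ε` of `λ` in the block bidiagonal pencil: block `(i, i)` equals
`E_{i,i} = [0 Ê_{i,i}]`, all other blocks vanish. -/
def bidiagE (k : ℕ) (t : ℕ → ℕ)
    (Ehat : ∀ i : ℕ, Matrix (Fin (t (i+1))) (Fin (t (i+1))) ℂ) :
    Matrix (Σ i : Fin (k-1), Fin (t ((i : ℕ)+1))) (Σ j : Fin k, Fin (t (j : ℕ))) ℂ :=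
  Matrix.of fun p q =>
    if h : (q.1 : ℕ) = (p.1 : ℕ) then
      padColsLeft t (p.1 : ℕ) (Ehat (p.1 : ℕ)) p.2 (Fin.cast (congrArg t h) q.2)
    else 0

/-- The product `Z_{j-1} ⋯ Z_1 Z_0` (equal to `I` for `j = 0`). -/
def Zprod (t : ℕ → ℕ) (A Ehat : ∀ i : ℕ, Matrix (Fin (t (i+1))) (Fin (t (i+1))) ℂ) :
    (j : ℕ) → Matrix (Fin (t j)) (Fin (t 0)) ℂ
  | 0 => 1
  | j + 1 => Zblk t A Ehat j * Zprod t A Ehat j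

/-- The candidate minimal basis `N(λ)`: block row `j` equals `λ^j Z_{j-1} ⋯ Z_1 Z_0`
(`I_{t_1}` for `j = 0`). -/
def Nmb (k : ℕ) (t : ℕ → ℕ) (A Ehat : ∀ i : ℕ, Matrix (Fin (t (i+1))) (Fin (t (i+1))) ℂ) :
    Matrix (Σ j : Fin k, Fin (t (j : ℕ))) (Fin (t 0)) (Polynomial ℂ) :=
  Matrix.of fun p b =>
    Polynomial.X ^ (p.1 : ℕ) * Polynomial.C (Zprod t A Ehat (p.1 : ℕ) p.2 b)
/-- `A_ε^†`: the block matrix whose `(i+1, i)` block equals `A_{i,i+1}⁻¹`, all other blocks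
zero. -/
def Adag (k : ℕ) (t : ℕ → ℕ)
    (A : ∀ i : ℕ, Matrix (Fin (t (i+1))) (Fin (t (i+1))) ℂ) :
    Matrix (Σ j : Fin k, Fin (t (j : ℕ))) (Σ i : Fin (k-1), Fin (t ((i : ℕ)+1))) ℂ :=
  Matrix.of fun q p =>
    if h : (q.1 : ℕ) = (p.1 : ℕ) + 1 then (A (p.1 : ℕ))⁻¹ (Fin.cast (congrArg t h) q.2) p.2
    else 0

/-- The nilpotent block matrix `Z` whose `(i+1, i)` block equals `Z_i`, all other blocks
zero. -/
def Znil (k : ℕ) (t : ℕ → ℕ)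
    (A Ehat : ∀ i : ℕ, Matrix (Fin (t (i+1))) (Fin (t (i+1))) ℂ) :
    Matrix (Σ j : Fin k, Fin (t (j : ℕ))) (Σ j : Fin k, Fin (t (j : ℕ))) ℂ :=
  Matrix.of fun p q =>
    if h : (p.1 : ℕ) = (q.1 : ℕ) + 1 then
      Zblk t A Ehat (q.1 : ℕ) (Fin.cast (congrArg t h) p.2) q.2
    else 0

theorem pencilMat_eq {ι κ : Type*} (L0 L1 : Matrix ι κ ℂ) :
    pencilMat L0 L1 = L0.map Polynomial.C + (Polynomial.X : Polynomial ℂ) • L1.map Polynomial.C := by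
  ext i j : 2
  simp [pencilMat]

/-- A telescoping right inverse of a pencil: if `L₀ D = 1` and `-D L₁` is nilpotent, then
`Σ λ^i (-D L₁)^i D` is a right inverse of `L₀ + λ L₁`. -/
theorem pencilMat_mul_sum_eq_one {ι κ : Type*} [Fintype ι] [DecidableEq ι] [Fintype κ]
    [DecidableEq κ] {L0 L1 : Matrix ι κ ℂ} {D : Matrix κ ι ℂ} {Z : Matrix κ κ ℂ} {k : ℕ}
    (hD : L0 * D = 1) (hZ : Z = -(D * L1)) (hk : Z ^ k = 0) :
    pencilMat L0 L1 * (∑ i ∈ Finset.range k,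
      (Polynomial.X : Polynomial ℂ) ^ i • ((Z ^ i * D).map Polynomial.C)) = 1 := by
  have hL1 : L1 = -(L0 * Z) := by
    rw [hZ, Matrix.mul_neg, ← Matrix.mul_assoc, hD, Matrix.one_mul, neg_neg]
  have key : ∀ n : ℕ, pencilMat L0 L1 * (∑ i ∈ Finset.range n,
      (Polynomial.X : Polynomial ℂ) ^ i • ((Z ^ i * D).map Polynomial.C)) =
      1 - (Polynomial.X : Polynomial ℂ) ^ n • ((L0 * (Z ^ n * D)).map Polynomial.C) := by
    intro n
    induction n with
    | zero => simp [hD]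
    | succ n ih =>
      have h1 : L1 * (Z ^ n * D) = -(L0 * (Z ^ (n + 1) * D)) := by
        rw [hL1, pow_succ']
        simp only [Matrix.neg_mul, Matrix.mul_assoc]
      have h2 : (-(L0 * (Z ^ (n + 1) * D))).map (Polynomial.C : ℂ →+* Polynomial ℂ) =
          -((L0 * (Z ^ (n + 1) * D)).map Polynomial.C) := by
        ext i j : 2
        simp only [Matrix.map_apply, Matrix.neg_apply, map_neg]
      rw [Finset.sum_range_succ, Matrix.mul_add, ih, pencilMat_eq, Matrix.add_mul,
        Matrix.mul_smul, Matrix.smul_mul, Matrix.mul_smul, ← Matrix.map_mul, ← Matrix.map_mul,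
        h1, h2, smul_neg, smul_neg, smul_smul, pow_succ' Polynomial.X n]
      abel
  rw [key, hk]
  simp

/-- `A_ε^†` is a right inverse of `A_ε` as soon as every block `A_{i,i+1}` is invertible. -/
theorem bidiagA_mul_Adag {k : ℕ} {t : ℕ → ℕ}
    {A : ∀ i : ℕ, Matrix (Fin (t (i+1))) (Fin (t (i+1))) ℂ}
    (hA : ∀ i, i + 1 < k → IsUnit (A i).det) :
    bidiagA k t A * Adag k t A = 1 := by
  ext ⟨⟨i, hi⟩, a⟩ ⟨⟨i', hi'⟩, b⟩
  have hik : i + 1 < k := by omega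
  rw [Matrix.mul_apply, Fintype.sum_sigma, Finset.sum_eq_single ⟨i + 1, hik⟩]
  · by_cases h : i = i'
    · subst h
      have := congrFun (congrFun (Matrix.mul_nonsing_inv (A i) (hA i hik)) a) b
      rw [Matrix.mul_apply] at this
      simpa [bidiagA, Adag, Matrix.one_apply] using this
    · simp [bidiagA, Adag, h]
  · intro j _ hj
    refine Finset.sum_eq_zero fun c _ => ?_
    have : ¬ (j : ℕ) = i + 1 := fun h => hj (Fin.ext h)
    simp [bidiagA, this]
  · simp

theorem mul_padColsLeft (t : ℕ → ℕ) (i : ℕ) (M N : Matrix (Fin (t (i+1))) (Fin (t (i+1))) ℂ) :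
    M * padColsLeft t i N = padColsLeft t i (M * N) := by
  ext a b
  by_cases h : (b : ℕ) < t i - t (i+1) <;> simp [padColsLeft, Matrix.mul_apply, h]

theorem padColsLeft_neg (t : ℕ → ℕ) (i : ℕ) (M : Matrix (Fin (t (i+1))) (Fin (t (i+1))) ℂ) :
    padColsLeft t i (-M) = -padColsLeft t i M := by
  ext a b
  by_cases h : (b : ℕ) < t i - t (i+1) <;> simp [padColsLeft, h]

theorem Znil_eq_neg_Adag_mul_bidiagE (k : ℕ) (t : ℕ → ℕ)
    (A Ehat : ∀ i : ℕ, Matrix (Fin (t (i+1))) (Fin (t (i+1))) ℂ) :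
    Znil k t A Ehat = -(Adag k t A * bidiagE k t Ehat) := by
  ext ⟨⟨i, hi⟩, a⟩ ⟨⟨j, hj⟩, b⟩
  rw [Matrix.neg_apply, Matrix.mul_apply, Fintype.sum_sigma]
  by_cases h : i = j + 1
  · subst h
    rw [Finset.sum_eq_single ⟨j, by omega⟩]
    · simp [Znil, Adag, bidiagE, Zblk, padColsLeft_neg, ← mul_padColsLeft, Matrix.mul_apply]
    · intro l _ hl
      refine Finset.sum_eq_zero fun c _ => ?_
      have : ¬ j = (l : ℕ) := fun h => hl (Fin.ext h.symm)
      simp [bidiagE, this]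
    · simp
  · have hz : Znil k t A Ehat ⟨⟨i, hi⟩, a⟩ ⟨⟨j, hj⟩, b⟩ = 0 := by simp [Znil, h]
    rw [hz, eq_comm, neg_eq_zero]
    refine Finset.sum_eq_zero fun l _ => Finset.sum_eq_zero fun c _ => ?_
    by_cases hl : j = (l : ℕ)
    · have : ¬ i = (l : ℕ) + 1 := hl ▸ h
      simp [Adag, this]
    · simp [bidiagE, hl]

theorem Znil_pow_apply_eq_zero {k : ℕ} {t : ℕ → ℕ}
    {A Ehat : ∀ i : ℕ, Matrix (Fin (t (i+1))) (Fin (t (i+1))) ℂ} (n : ℕ)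
    (p q : Σ j : Fin k, Fin (t (j : ℕ))) (h : (p.1 : ℕ) ≠ (q.1 : ℕ) + n) :
    (Znil k t A Ehat ^ n) p q = 0 := by
  induction n generalizing q with
  | zero =>
    rw [pow_zero, Matrix.one_apply_ne]
    rintro rfl
    exact h rfl
  | succ n ih =>
    rw [pow_succ, Matrix.mul_apply]
    refine Finset.sum_eq_zero fun r _ => ?_
    by_cases hr : (r.1 : ℕ) = (q.1 : ℕ) + 1
    · rw [ih r (by omega), zero_mul]
    · simp [Znil, hr]

theorem Znil_pow_eq_zero (k : ℕ) (t : ℕ → ℕ)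
    (A Ehat : ∀ i : ℕ, Matrix (Fin (t (i+1))) (Fin (t (i+1))) ℂ) :
    Znil k t A Ehat ^ k = 0 := by
  ext p q
  exact Znil_pow_apply_eq_zero k p q (by have := p.1.isLt; omega)

/-- Corollary: the right inverse of the block bidiagonal pencil. With the
pencil `A_ε + λE_ε` as in the previous statement: (i) `A_ε A_ε^† = I`; (ii) `Z = −A_ε^† E_ε`
and `Z^k = 0`; (iii) `R(λ) = (Σ_{i<k} λ^i Z^i) A_ε^†` is a polynomial right inverse of
`A_ε + λE_ε`. -/
theorem right_inverse_of_bidiagonal_pencil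
    (k : ℕ) (hk : 2 ≤ k) (t : ℕ → ℕ)
    (htpos : ∀ i, i < k → 1 ≤ t i)
    (hmono : ∀ i, i + 1 < k → t (i + 1) ≤ t i)
    (A Ehat : ∀ i : ℕ, Matrix (Fin (t (i+1))) (Fin (t (i+1))) ℂ)
    (hAtri : ∀ i, i + 1 < k → ∀ a b : Fin (t (i+1)), (b : ℕ) < (a : ℕ) → A i a b = 0)
    (hAdiag : ∀ i, i + 1 < k → ∀ a : Fin (t (i+1)), A i a a ≠ 0)
    (hEtri : ∀ i, i + 1 < k → ∀ a b : Fin (t (i+1)), (b : ℕ) < (a : ℕ) → Ehat i a b = 0)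
    (hEdiag : ∀ i, i + 1 < k → ∀ a : Fin (t (i+1)), Ehat i a a ≠ 0) :
    bidiagA k t A * Adag k t A = 1 ∧
    Znil k t A Ehat = -(Adag k t A * bidiagE k t Ehat) ∧
    Znil k t A Ehat ^ k = 0 ∧
    pencilMat (bidiagA k t A) (bidiagE k t Ehat) *
      (∑ i ∈ Finset.range k,
        (Polynomial.X : Polynomial ℂ) ^ i • ((Znil k t A Ehat ^ i * Adag k t A).map Polynomial.C)) = 1 := by
  have hdet : ∀ i, i + 1 < k → IsUnit (A i).det := by
    intro i hi
    rw [Matrix.det_of_isUpperTriangular fun a b hab => hAtri i hi a b hab, isUnit_iff_ne_zero]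
    exact Finset.prod_ne_zero_iff.mpr fun a _ => hAdiag i hi a
  have hD := bidiagA_mul_Adag hdet
  have hZ := Znil_eq_neg_Adag_mul_bidiagE k t A Ehat
  have hk0 := Znil_pow_eq_zero k t A Ehat
  exact ⟨hD, hZ, hk0, pencilMat_mul_sum_eq_one hD hZ hk0⟩

end
end
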